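/- Let ν > 1 and s_U = ν/(1+ν), s_Y' = (ν+√(2ν(ν+1)))/(2(ν+2)). For s_M ∈ (s_U, 1], consider the quadratic 2·s_M·(1+ν)·x² - (2·s_M + 1)·ν·x + ν·s_M = 0 in x. Its discriminant equals -ν·((4ν+8)·s_M² - 4ν·s_M - ν), and the discriminant is nonnegative if and only if s_M ≤ s_Y'. Moreover, when s_M = s_Y', the (double) root is x = (1/2)·√(2ν/(ν+1)) = s_Y. -/

import Mathlib

theorem stmt_8 (ν : ℝ) (hν : 1 < ν)
    (sU sY sY' : ℝ)
    (hsU : sU = ν / (1 + ν))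
    (hsY : sY = (1/2) * Real.sqrt (2*ν/(ν+1)))
    (hsY' : sY' = (ν + Real.sqrt (2*ν*(ν+1))) / (2*(ν+2)))
    (sM : ℝ) (hM : sU < sM) (hM1 : sM ≤ 1) :
    ((2*sM+1)*ν)^2 - 4*(2*sM*(1+ν))*(ν*sM) = -ν*((4*ν+8)*sM^2 - 4*ν*sM - ν) ∧
    (0 ≤ -ν*((4*ν+8)*sM^2 - 4*ν*sM - ν) ↔ sM ≤ sY') ∧
    (sM = sY' → 2*sM*(1+ν)*sY^2 - (2*sM+1)*ν*sY + ν*sM = 0) := by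
  have hν0 : 0 < ν := by linarith
  have hs : 0 < sM := lt_trans (by rw [hsU]; positivity) hM
  have hsqrt : Real.sqrt (2*ν/(ν+1)) = Real.sqrt (2*ν*(ν+1)) / (ν+1) := by
    rw [show 2*ν/(ν+1) = 2*ν*(ν+1) / (ν+1)^2 by field_simp,
      Real.sqrt_div (by positivity), Real.sqrt_sq (by positivity)]
  have hR : Real.sqrt (2*ν*(ν+1)) ^ 2 = 2*ν*(ν+1) := Real.sq_sqrt (by positivity)
  have hνR : ν < Real.sqrt (2*ν*(ν+1)) := Real.lt_sqrt_of_sq_lt (by nlinarith)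
  rw [hsqrt] at hsY
  set R := Real.sqrt (2*ν*(ν+1))
  refine ⟨by ring, ?_, ?_⟩
  · have hfac : -ν*((4*ν+8)*sM^2 - 4*ν*sM - ν) =
        ν / (ν+2) * (2*(ν+2)*sM - ν + R) * (ν + R - sM*(2*(ν+2))) := by
      field_simp
      linear_combination -hR
    have hpos : 0 < ν / (ν+2) * (2*(ν+2)*sM - ν + R) := by
      have : 0 < 2*(ν+2)*sM := by positivity
      exact mul_pos (by positivity) (by linarith)
    rw [hfac, mul_nonneg_iff_of_pos_left hpos, sub_nonneg, hsY', le_div_iff₀ (by positivity)]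
  · rintro rfl
    rw [hsY, hsY']
    field_simp
    grind
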